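/- Well-posedness and consistency of the Drucker–Prager smooth return: in the smooth-return case (Ψ(σ^tr) > 0 and η p^tr − (Kη²/(G√2)) ρ^tr < c) one has ρ^tr > 0 (so n^tr is well defined), dev(σ_k) = (ρ^tr − G√2·Ψ(σ^tr)/(G + Kη²))·n^tr with nonnegative scalar coefficient ρ^tr − G√2·Ψ(σ^tr)/(G + Kη²) ≥ 0, and the consistency condition Ψ(σ_k) = 0 holds. -/

import Mathlib

open Matrix

/-- Frobenius inner product on 3×3 real matrices. -/
noncomputable def frob (σ τ : Matrix (Fin 3) (Fin 3) ℝ) : ℝ := ∑ i, ∑ j, σ i j * τ i j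

/-- Frobenius norm. -/
noncomputable def fnorm (τ : Matrix (Fin 3) (Fin 3) ℝ) : ℝ := Real.sqrt (frob τ τ)

/-- Deviatoric part. -/
noncomputable def devM (τ : Matrix (Fin 3) (Fin 3) ℝ) : Matrix (Fin 3) (Fin 3) ℝ :=
  τ - (Matrix.trace τ / 3) • (1 : Matrix (Fin 3) (Fin 3) ℝ)

/-- The isotropic elasticity tensor `ℂε = K tr(ε) I + 2G dev(ε)`. -/
noncomputable def Celast (K G : ℝ) (ε : Matrix (Fin 3) (Fin 3) ℝ) : Matrix (Fin 3) (Fin 3) ℝ :=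
  (K * Matrix.trace ε) • (1 : Matrix (Fin 3) (Fin 3) ℝ) + (2 * G) • devM ε

/-- The Drucker–Prager yield function `Ψ(τ) = √(1/2)|dev τ| + (η/3) tr τ − c`. -/
noncomputable def PsiDP (η c : ℝ) (τ : Matrix (Fin 3) (Fin 3) ℝ) : ℝ :=
  Real.sqrt (1 / 2) * fnorm (devM τ) + η / 3 * Matrix.trace τ - c

theorem fnorm_smul (a : ℝ) (τ : Matrix (Fin 3) (Fin 3) ℝ) : fnorm (a • τ) = |a| * fnorm τ := by
  have h : frob (a • τ) (a • τ) = a ^ 2 * frob τ τ := by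
    simp only [frob, Matrix.smul_apply, smul_eq_mul, Finset.mul_sum]
    refine Finset.sum_congr rfl fun i _ => Finset.sum_congr rfl fun j _ => ?_
    ring
  rw [fnorm, h, Real.sqrt_mul (sq_nonneg a), Real.sqrt_sq_eq_abs, fnorm]

theorem trace_devM (τ : Matrix (Fin 3) (Fin 3) ℝ) : Matrix.trace (devM τ) = 0 := by
  simp only [devM, Matrix.trace_sub, Matrix.trace_smul, Matrix.trace_one, Fintype.card_fin,
    smul_eq_mul]
  norm_num

/-- The deviatoric part is unchanged by adding multiples of the identity, and is affine in
trace-free directions. -/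
theorem devM_sub_smul_sub_smul_one (σ τ : Matrix (Fin 3) (Fin 3) ℝ) (hτ : Matrix.trace τ = 0)
    (a b : ℝ) : devM (σ - a • τ - b • (1 : Matrix (Fin 3) (Fin 3) ℝ)) = devM σ - a • τ := by
  simp only [devM, Matrix.trace_sub, Matrix.trace_smul, Matrix.trace_one, Fintype.card_fin,
    smul_eq_mul, hτ]
  push_cast
  module

/-- Well-posedness and consistency of the Drucker–Prager smooth return: in the
smooth-return case `ρ^tr > 0`, `dev σₖ = (ρ^tr − G√2 Ψ(σ^tr)/(G+Kη²)) n^tr` with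
nonnegative coefficient, and the consistency condition `Ψ(σₖ) = 0` holds. -/
theorem druckerPrager_smooth_return_consistency (K G η c : ℝ)
    (hK : 0 < K) (hG : 0 < G) (hη : 0 < η) (hc : 0 < c)
    (εk εp : Matrix (Fin 3) (Fin 3) ℝ) (hεk : εk.IsSymm) (hεp : εp.IsSymm)
    (σtr str ntr σk : Matrix (Fin 3) (Fin 3) ℝ) (ρtr ptr Δlam : ℝ)
    (hσtr : σtr = Celast K G (εk - εp))
    (hstr : str = devM σtr) (hρtr : ρtr = fnorm str)
    (hptr : ptr = Matrix.trace σtr / 3)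
    (hcase1 : 0 < PsiDP η c σtr)
    (hcase2 : η * ptr - K * η ^ 2 / (G * Real.sqrt 2) * ρtr < c)
    (hntr : ntr = ρtr⁻¹ • str)
    (hΔlam : Δlam = PsiDP η c σtr / (G + K * η ^ 2))
    (hσk : σk = σtr - (Δlam * (G * Real.sqrt 2)) • ntr -
      (Δlam * (K * η)) • (1 : Matrix (Fin 3) (Fin 3) ℝ)) :
    0 < ρtr ∧
    devM σk = (ρtr - G * Real.sqrt 2 * PsiDP η c σtr / (G + K * η ^ 2)) • ntr ∧
    0 ≤ ρtr - G * Real.sqrt 2 * PsiDP η c σtr / (G + K * η ^ 2) ∧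
    PsiDP η c σk = 0 := by
  have hs : 0 < Real.sqrt 2 := by positivity
  have hss : Real.sqrt 2 * Real.sqrt 2 = 2 := Real.mul_self_sqrt (by norm_num)
  have hhalf : Real.sqrt (1 / 2) = Real.sqrt 2 / 2 := by
    rw [Real.sqrt_div zero_le_one, Real.sqrt_one, div_eq_div_iff hs.ne' two_ne_zero, hss, one_mul]
  have hD : 0 < G + K * η ^ 2 := by positivity
  have hΨ : PsiDP η c σtr = Real.sqrt 2 / 2 * ρtr + η * ptr - c := by
    rw [PsiDP, hhalf, ← hstr, ← hρtr, hptr]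
    ring
  have hρ : 0 < ρtr := by
    refine lt_of_le_of_ne (hρtr ▸ Real.sqrt_nonneg _) fun h => ?_
    rw [← h] at hΨ hcase2
    linarith
  have hntr_trace : Matrix.trace ntr = 0 := by
    rw [hntr, Matrix.trace_smul, hstr, trace_devM, smul_zero]
  have hntr_norm : fnorm ntr = 1 := by
    rw [hntr, fnorm_smul, ← hρtr, abs_of_pos (inv_pos.mpr hρ), inv_mul_cancel₀ hρ.ne']
  have hstr_ntr : devM σtr = ρtr • ntr := by
    rw [hntr, smul_inv_smul₀ hρ.ne', hstr]
  have hcoef : G * Real.sqrt 2 * PsiDP η c σtr / (G + K * η ^ 2)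
      = Δlam * (G * Real.sqrt 2) := by
    rw [hΔlam]
    ring
  have hdev : devM σk = (ρtr - Δlam * (G * Real.sqrt 2)) • ntr := by
    rw [hσk, devM_sub_smul_sub_smul_one _ _ hntr_trace, hstr_ntr, sub_smul]
  have hnonneg : 0 ≤ ρtr - G * Real.sqrt 2 * PsiDP η c σtr / (G + K * η ^ 2) := by
    have h : η * ptr - c < K * η ^ 2 * ρtr / (G * Real.sqrt 2) := by
      rw [mul_div_right_comm]
      linarith
    rw [lt_div_iff₀ (by positivity)] at h
    rw [sub_nonneg, div_le_iff₀ hD, hΨ]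
    linear_combination h.le + G * ρtr / 2 * hss
  refine ⟨hρ, by rw [hcoef, hdev], hnonneg, ?_⟩
  have htrace : Matrix.trace σk = 3 * (ptr - Δlam * (K * η)) := by
    rw [hσk, hptr]
    simp only [Matrix.trace_sub, Matrix.trace_smul, Matrix.trace_one, Fintype.card_fin,
      smul_eq_mul, hntr_trace]
    push_cast
    ring
  rw [hcoef] at hnonneg
  have hΔ : Δlam * (G + K * η ^ 2) = PsiDP η c σtr := by
    rw [hΔlam, div_mul_cancel₀ _ hD.ne']
  rw [PsiDP, hdev, fnorm_smul, hntr_norm, abs_of_nonneg hnonneg, htrace, hhalf]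
  linear_combination -hΔ - hΨ - Δlam * G / 2 * hss
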